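/- Let γ ⊂ ℝⁿ (n ≥ 2) be a steepest descent curve (arclength parametrization x(s) satisfying ⟨x'(s), x(s)−x(σ)⟩ ≥ 0 for σ ≤ s, a.e. s). Then for a.e. s, d/ds w(co(γ(s))) ≥ m_n, where γ(s) = {x(σ) : 0 ≤ σ ≤ s}, w denotes mean width, and m_n = min{Φ(S,u) : S sector with S ⊇ S*, u ∈ S*} > 0. In particular d/ds w(co(γ(s))) ≥ (ω_{n-1}/(ω_n(n-1))) n^{-n/2} a.e. -/

import Mathlib

open RealInnerProductSpace Set MeasureTheory

/-- `ω n = 2 π^{n/2} / Γ(n/2)`, the surface measure of `S^{n-1}`. -/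
noncomputable def sphereMeasureConst (n : ℕ) : ℝ :=
  2 * Real.pi ^ ((n : ℝ) / 2) / Real.Gamma ((n : ℝ) / 2)

/-- The support function of a set. -/
noncomputable def suppFn {n : ℕ} (K : Set (EuclideanSpace ℝ (Fin n)))
    (θ : EuclideanSpace ℝ (Fin n)) : ℝ :=
  sSup ((fun y => ⟪θ, y⟫) '' K)

/-- The mean width `w(K) = (2/ω_n) ∫_{S^{n-1}} h_K dσ`. -/
noncomputable def meanWidth {n : ℕ} (K : Set (EuclideanSpace ℝ (Fin n))) : ℝ :=
  2 / sphereMeasureConst n *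
    ∫ θ in Metric.sphere (0 : EuclideanSpace ℝ (Fin n)) 1, suppFn K θ ∂(μH[(n : ℝ) - 1])

/-- A sector: a compact convex subset of a hemisphere of the unit sphere. -/
def IsSector {n : ℕ} (S : Set (EuclideanSpace ℝ (Fin n))) : Prop :=
  IsCompact S ∧
    (∃ C : Set (EuclideanSpace ℝ (Fin n)), Convex ℝ C ∧
      (∀ x ∈ C, ∀ r : ℝ, 0 ≤ r → r • x ∈ C) ∧
      S = C ∩ Metric.sphere (0 : EuclideanSpace ℝ (Fin n)) 1) ∧
    ∃ e : EuclideanSpace ℝ (Fin n), ‖e‖ = 1 ∧ ∀ x ∈ S, 0 ≤ ⟪e, x⟫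

/-- The dual sector. -/
def sectorDual {n : ℕ} (S : Set (EuclideanSpace ℝ (Fin n))) :
    Set (EuclideanSpace ℝ (Fin n)) :=
  {y ∈ Metric.sphere (0 : EuclideanSpace ℝ (Fin n)) 1 | ∀ x ∈ S, 0 ≤ ⟪y, x⟫}

/-- The functional `Φ(S, u)`. -/
noncomputable def PhiFun {n : ℕ} (S : Set (EuclideanSpace ℝ (Fin n)))
    (u : EuclideanSpace ℝ (Fin n)) : ℝ :=
  2 / sphereMeasureConst n * ∫ θ in S, ⟪θ, u⟫ ∂(μH[(n : ℝ) - 1])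

/-- A set of unit vectors of pairwise nonnegative inner products lies in a spherical cap whose
radius depends only on the dimension. -/
lemma exists_unit_inner_ge {E : Type*} [NormedAddCommGroup E] [InnerProductSpace ℝ E]
    [FiniteDimensional ℝ E] {A : Set E} (hne : A.Nonempty) (hunit : ∀ y ∈ A, ‖y‖ = 1)
    (hpair : ∀ y ∈ A, ∀ z ∈ A, 0 ≤ ⟪y, z⟫) :
    ∃ e : E, ‖e‖ = 1 ∧ ∀ y ∈ A, (√(Module.finrank ℝ E + 1))⁻¹ ≤ ⟪e, y⟫ := by
  set N : ℝ := Module.finrank ℝ E + 1 with hN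
  have hNpos : 0 < N := by positivity
  have hhull : ∀ v ∈ convexHull ℝ A, N⁻¹ ≤ ‖v‖ ^ 2 := by
    intro v hv
    obtain ⟨ι, _, z, w, hz, haff, hw, hsum, rfl⟩ := eq_pos_convex_span_of_mem_convexHull hv
    have hzA : ∀ i, z i ∈ A := fun i => hz ⟨i, rfl⟩
    have hcard : (Fintype.card ι : ℝ) ≤ N := by
      have := haff.card_le_finrank_succ
      have h2 := Submodule.finrank_le (vectorSpan ℝ (Set.range z))
      rw [hN]; exact_mod_cast this.trans (by omega)
    have h1 : ∑ i, w i ^ 2 ≤ ‖∑ i, w i • z i‖ ^ 2 := by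
      rw [← real_inner_self_eq_norm_sq, sum_inner]
      refine Finset.sum_le_sum fun i _ => ?_
      rw [inner_sum]
      have : w i ^ 2 = ⟪w i • z i, w i • z i⟫ := by
        rw [real_inner_self_eq_norm_sq, norm_smul, hunit _ (hzA i)]; simp
      rw [this]
      refine Finset.single_le_sum (f := fun j => ⟪w i • z i, w j • z j⟫) (fun j _ => ?_)
        (Finset.mem_univ i)
      simp only [real_inner_smul_left, real_inner_smul_right]
      have := hpair _ (hzA i) _ (hzA j)
      have := (hw i).le
      have := (hw j).le
      positivity
    have h2 : (∑ i, w i) ^ 2 ≤ Fintype.card ι * ∑ i, w i ^ 2 :=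
      sq_sum_le_card_mul_sum_sq
    rw [hsum] at h2
    have h3 : 0 ≤ ∑ i, w i ^ 2 := Finset.sum_nonneg fun i _ => sq_nonneg _
    rw [inv_le_iff_one_le_mul₀' hNpos]
    nlinarith
  obtain ⟨p, hp, hmin⟩ := exists_norm_eq_iInf_of_complete_convex
    (K := closure (convexHull ℝ A)) hne.convexHull.closure isClosed_closure.isComplete
    (convex_convexHull ℝ A).closure 0
  rw [norm_eq_iInf_iff_real_inner_le_zero (convex_convexHull ℝ A).closure hp] at hmin
  have hpn : N⁻¹ ≤ ‖p‖ ^ 2 := by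
    have hcl : IsClosed {v : E | N⁻¹ ≤ ‖v‖ ^ 2} := isClosed_le continuous_const (by fun_prop)
    exact closure_minimal (fun v hv => hhull v hv) hcl hp
  have hp0 : 0 < ‖p‖ := by
    rw [norm_pos_iff]; rintro rfl
    simp at hpn; linarith
  refine ⟨‖p‖⁻¹ • p, by simp [norm_smul, hp0.ne'], fun y hy => ?_⟩
  have h := hmin y (subset_closure (subset_convexHull ℝ A hy))
  rw [zero_sub, inner_neg_left, inner_sub_right, real_inner_self_eq_norm_sq] at h
  have h4 : (√N)⁻¹ ≤ ‖p‖ := by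
    rw [← Real.sqrt_inv]; exact Real.sqrt_le_iff.2 ⟨hp0.le, hpn⟩
  rw [real_inner_smul_left]
  refine h4.trans ?_
  rw [inv_mul_eq_div, le_div_iff₀ hp0]
  nlinarith

/-- Unit vectors whose angles to a unit vector `e` add up to at most a right angle have
nonnegative inner product. -/
lemma inner_nonneg_of_one_le_sq_add_sq {E : Type*} [NormedAddCommGroup E] [InnerProductSpace ℝ E]
    {θ e y : E} (hθ : ‖θ‖ = 1) (he : ‖e‖ = 1) (hy : ‖y‖ = 1) (h1 : 0 ≤ ⟪θ, e⟫)
    (h2 : 0 ≤ ⟪e, y⟫) (h : 1 ≤ ⟪θ, e⟫ ^ 2 + ⟪e, y⟫ ^ 2) : 0 ≤ ⟪θ, y⟫ := by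
  set a := ⟪θ, e⟫ with ha
  set b := ⟪e, y⟫ with hb
  have hee : ⟪e, e⟫ = 1 := by rw [real_inner_self_eq_norm_sq, he]; norm_num
  have htt : ⟪θ, θ⟫ = 1 := by rw [real_inner_self_eq_norm_sq, hθ]; norm_num
  have hyy : ⟪y, y⟫ = 1 := by rw [real_inner_self_eq_norm_sq, hy]; norm_num
  have hcs := real_inner_mul_inner_self_le (θ - a • e) (y - b • e)
  have hA : ⟪θ - a • e, y - b • e⟫ = ⟪θ, y⟫ - a * b := by
    simp only [inner_sub_left, inner_sub_right, real_inner_smul_left, real_inner_smul_right, hee,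
      ← ha, ← hb]; ring
  have hB : ⟪θ - a • e, θ - a • e⟫ = 1 - a ^ 2 := by
    simp only [inner_sub_left, inner_sub_right, real_inner_smul_left, real_inner_smul_right, hee,
      ← ha, real_inner_comm θ e, htt]; ring
  have hC : ⟪y - b • e, y - b • e⟫ = 1 - b ^ 2 := by
    simp only [inner_sub_left, inner_sub_right, real_inner_smul_left, real_inner_smul_right, hee,
      ← hb, real_inner_comm e y, hyy]; ring
  rw [hA, hB, hC] at hcs
  by_contra hneg
  push Not at hneg
  nlinarith [mul_nonneg h1 h2]

/-- A Lipschitz function whose derivative is almost everywhere nonnegative is nondecreasing. -/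
lemma LipschitzOnWith.le_of_ae_deriv_nonneg {f : ℝ → ℝ} {a b : ℝ} {K : NNReal} (hab : a ≤ b)
    (hf : LipschitzOnWith K f (Icc a b))
    (hd : ∀ᵐ t ∂(volume.restrict (Icc a b)), 0 ≤ deriv f t) : f a ≤ f b := by
  rw [← uIcc_of_le hab] at hf
  have h := hf.absolutelyContinuousOnInterval.integral_deriv_eq_sub
  have : 0 ≤ ∫ t in a..b, deriv f t :=
    intervalIntegral.integral_nonneg_of_ae_restrict hab hd
  linarith

/-- The unit sphere of `ℝ^(m+1)` has finite `m`-dimensional Hausdorff measure. -/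
lemma hausdorffMeasure_unitSphere_lt_top (m : ℕ) :
    μH[(m : ℝ)] (Metric.sphere (0 : EuclideanSpace ℝ (Fin (m + 1))) 1) < ⊤ := by
  let G : Fin (m + 1) → ℝ → (Fin m → ℝ) → EuclideanSpace ℝ (Fin (m + 1)) := fun i ε z =>
    ε • ((√(1 + ∑ j, z j ^ 2))⁻¹ • WithLp.toLp 2 (i.insertNth (1 : ℝ) z))
  have hpos : ∀ z : Fin m → ℝ, 0 < 1 + ∑ j, z j ^ 2 := fun z => by positivity
  have hG : ∀ i ε, ContDiff ℝ 1 (G i ε) := by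
    intro i ε
    have hA : ContDiff ℝ 1 fun z : Fin m → ℝ => (√(1 + ∑ j, z j ^ 2))⁻¹ := by
      refine ContDiff.inv ?_ fun z => (Real.sqrt_pos.2 (hpos z)).ne'
      exact ContDiff.sqrt (by fun_prop) fun z => (hpos z).ne'
    have hB : ContDiff ℝ 1 fun z : Fin m → ℝ =>
        (WithLp.toLp 2 (i.insertNth (1 : ℝ) z) : EuclideanSpace ℝ (Fin (m + 1))) := by
      rw [contDiff_euclidean]
      intro k
      rcases Fin.eq_self_or_eq_succAbove i k with rfl | ⟨j, rfl⟩
      · simpa using contDiff_const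
      · simp only [Fin.insertNth_apply_succAbove]; fun_prop
    exact (hA.smul hB).const_smul ε
  have hfin : ∀ i ε, μH[(m : ℝ)] (G i ε '' Icc (fun _ => -1) (fun _ => 1)) < ⊤ := by
    intro i ε
    obtain ⟨K, hK⟩ := (hG i ε).locallyLipschitz.locallyLipschitzOn
      |>.exists_lipschitzOnWith_of_compact (s := Icc (fun _ : Fin m => (-1 : ℝ)) (fun _ => 1))
        isCompact_Icc
    refine (hK.hausdorffMeasure_image_le (Nat.cast_nonneg m)).trans_lt ?_
    have h := hausdorffMeasure_pi_real (ι := Fin m)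
    rw [Fintype.card_fin] at h
    rw [h]
    exact ENNReal.mul_lt_top (by simp) isCompact_Icc.measure_lt_top
  have hcover : Metric.sphere (0 : EuclideanSpace ℝ (Fin (m + 1))) 1 ⊆
      ⋃ i : Fin (m + 1), ((G i 1 '' Icc (fun _ => -1) (fun _ => 1)) ∪
        (G i (-1) '' Icc (fun _ => -1) (fun _ => 1))) := by
    intro x hx
    have hx1 : ∑ k, x k ^ 2 = 1 := by
      rw [← EuclideanSpace.real_norm_sq_eq, mem_sphere_zero_iff_norm.1 hx]; norm_num
    obtain ⟨i, hi⟩ := Finite.exists_max fun k => |x k|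
    have hxi : x i ≠ 0 := by
      intro h0
      have : ∀ k, x k = 0 := fun k => by
        have := hi k
        rw [h0, abs_zero] at this
        exact abs_nonpos_iff.1 this
      simp [this] at hx1
    set z : Fin m → ℝ := fun j => x (i.succAbove j) / x i with hz
    have hzI : z ∈ Icc (fun _ : Fin m => (-1 : ℝ)) (fun _ => 1) := by
      have : ∀ j, |z j| ≤ 1 := fun j => by
        rw [hz, abs_div]; exact div_le_one_of_le₀ (hi _) (abs_nonneg _)
      exact ⟨fun j => (abs_le.1 (this j)).1, fun j => (abs_le.1 (this j)).2⟩
    have hsum : 1 + ∑ j, z j ^ 2 = (x i ^ 2)⁻¹ := by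
      rw [Fin.sum_univ_succAbove _ i] at hx1
      simp only [hz, div_pow]
      rw [← Finset.sum_div]
      field_simp
      linarith
    have hGz : ∀ ε, G i ε z = (ε * (|x i| / x i)) • x := by
      intro ε
      have h1 : (√(1 + ∑ j, z j ^ 2))⁻¹ = |x i| := by
        rw [hsum, Real.sqrt_inv, Real.sqrt_sq_eq_abs, inv_inv]
      ext k
      simp only [G, h1, PiLp.smul_apply, smul_eq_mul]
      rcases Fin.eq_self_or_eq_succAbove i k with rfl | ⟨j, rfl⟩
      · simp [hxi, mul_assoc]
      · simp [hz]; field_simp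
    refine mem_iUnion.2 ⟨i, ?_⟩
    rcases lt_or_gt_of_ne hxi with h | h
    · refine Or.inr ⟨z, hzI, ?_⟩
      rw [hGz, abs_of_neg h, neg_div, div_self hxi]; simp
    · refine Or.inl ⟨z, hzI, ?_⟩
      rw [hGz, abs_of_pos h, div_self hxi]; simp
  refine (measure_mono hcover).trans_lt ?_
  refine (measure_iUnion_le _).trans_lt ?_
  rw [tsum_fintype]
  exact ENNReal.sum_lt_top.2 fun i _ =>
    (measure_union_le _ _).trans_lt (ENNReal.add_lt_top.2 ⟨hfin i 1, hfin i (-1)⟩)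

/-- The Hausdorff measure on `ℝ^m` dominates the Lebesgue measure. -/
lemma volume_le_hausdorffMeasure (m : ℕ) (s : Set (EuclideanSpace ℝ (Fin m))) :
    volume s ≤ μH[(m : ℝ)] s := by
  have h := hausdorffMeasure_pi_real (ι := Fin m)
  rw [Fintype.card_fin] at h
  have h1 := (PiLp.lipschitzWith_ofLp 2 (fun _ : Fin m => ℝ)).hausdorffMeasure_image_le
    (Nat.cast_nonneg m) s
  rw [h] at h1
  simp only [ENNReal.coe_one, ENNReal.one_rpow, one_mul] at h1
  refine le_trans (le_of_eq ?_) h1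
  have h2 := (EuclideanSpace.volume_preserving_symm_measurableEquiv_toLp (Fin m)).symm
    |>.measure_preimage_equiv s
  rw [← h2]
  congr 1
  ext v
  constructor
  · intro hv; exact ⟨_, hv, rfl⟩
  · rintro ⟨w, hw, rfl⟩; exact hw

/-- A spherical cap projects onto a ball in the hyperplane orthogonal to its axis. -/
lemma volume_closedBall_le_hausdorffMeasure_cap {m : ℕ} {e : EuclideanSpace ℝ (Fin (m + 1))}
    (he : ‖e‖ = 1) {ρ c : ℝ} (hρ : ρ ^ 2 + c ^ 2 ≤ 1) :
    volume (Metric.closedBall (0 : EuclideanSpace ℝ (Fin m)) ρ) ≤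
      μH[(m : ℝ)] {θ ∈ Metric.sphere (0 : EuclideanSpace ℝ (Fin (m + 1))) 1 | c ≤ ⟪θ, e⟫} := by
  have he0 : e ≠ 0 := by rintro rfl; simp at he
  have : Fact (Module.finrank ℝ (EuclideanSpace ℝ (Fin (m + 1))) = m + 1) := ⟨by simp⟩
  let b := OrthonormalBasis.fromOrthogonalSpanSingleton (𝕜 := ℝ) m he0
  set P := (Submodule.span ℝ {e})ᗮ
  set C := {θ ∈ Metric.sphere (0 : EuclideanSpace ℝ (Fin (m + 1))) 1 | c ≤ ⟪θ, e⟫}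
  refine (volume_le_hausdorffMeasure m _).trans ?_
  have hsub : Metric.closedBall (0 : EuclideanSpace ℝ (Fin m)) ρ ⊆
      b.repr '' (P.orthogonalProjectionOnto '' C) := by
    intro v hv
    have hvn : ‖v‖ ≤ ρ := by simpa using hv
    set z : P := b.repr.symm v with hz
    have hzn : ‖z‖ = ‖v‖ := b.repr.symm.norm_map v
    have hze : ⟪(z : EuclideanSpace ℝ (Fin (m + 1))), e⟫ = 0 := by
      rw [real_inner_comm]
      exact Submodule.mem_orthogonal_singleton_iff_inner_right.1 z.2
    have hc : c ≤ √(1 - ‖v‖ ^ 2) := by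
      refine Real.le_sqrt_of_sq_le ?_
      nlinarith [norm_nonneg v]
    have hnn : 0 ≤ 1 - ‖v‖ ^ 2 := by nlinarith [norm_nonneg v, sq_nonneg c]
    set t := √(1 - ‖v‖ ^ 2) with ht
    refine ⟨z, ⟨(z : EuclideanSpace ℝ (Fin (m + 1))) + t • e, ⟨?_, ?_⟩, ?_⟩, by simp [hz]⟩
    · rw [mem_sphere_zero_iff_norm]
      have : ‖(z : EuclideanSpace ℝ (Fin (m + 1))) + t • e‖ ^ 2 = 1 := by
        rw [norm_add_sq_real, real_inner_smul_right, hze, norm_smul, he, mul_one, Real.norm_eq_abs,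
          sq_abs, ht, Real.sq_sqrt hnn, ← Submodule.coe_norm, hzn]
        ring
      nlinarith [norm_nonneg ((z : EuclideanSpace ℝ (Fin (m + 1))) + t • e)]
    · rw [inner_add_left, hze, real_inner_smul_left, real_inner_self_eq_norm_sq, he]
      simpa using hc
    · rw [map_add, map_smul, Submodule.orthogonalProjectionOnto_mem_subspace_eq_self,
        Submodule.orthogonalProjectionOnto_orthogonal_apply_eq_zero]
      · simp
      · exact Submodule.mem_span_singleton_self e
  refine (measure_mono hsub).trans ?_
  rw [b.repr.isometry.hausdorffMeasure_image (Or.inl (Nat.cast_nonneg m))]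
  exact hausdorffMeasure_orthogonalProjectionOnto_le P _ _ (Nat.cast_nonneg m)

lemma measurableSet_cap {m : ℕ} (e : EuclideanSpace ℝ (Fin (m + 1))) (c : ℝ) :
    MeasurableSet
      {θ ∈ Metric.sphere (0 : EuclideanSpace ℝ (Fin (m + 1))) 1 | c ≤ ⟪θ, e⟫} :=
  (Metric.isClosed_sphere.inter
    (isClosed_le continuous_const (by fun_prop : Continuous fun θ => ⟪θ, e⟫))).measurableSet

lemma Continuous.integrableOn_unitSphere {m : ℕ} {F : Type*} [NormedAddCommGroup F]
    {f : EuclideanSpace ℝ (Fin (m + 1)) → F} (hf : Continuous f) :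
    IntegrableOn f (Metric.sphere 0 1) μH[(m : ℝ)] := by
  obtain ⟨C, hC⟩ := (isCompact_sphere (0 : EuclideanSpace ℝ (Fin (m + 1))) 1)
    |>.exists_bound_of_continuousOn hf.continuousOn
  refine IntegrableOn.of_bound (hausdorffMeasure_unitSphere_lt_top m)
    (hf.continuousOn.aestronglyMeasurable_of_isCompact (isCompact_sphere _ _)
      Metric.isClosed_sphere.measurableSet) C ?_
  exact (ae_restrict_iff' Metric.isClosed_sphere.measurableSet).2 (.of_forall hC)

/-- The first moment of a spherical cap is directed along its axis. -/
lemma setIntegral_inner_cap {m : ℕ} {e : EuclideanSpace ℝ (Fin (m + 1))} (he : ‖e‖ = 1) (c : ℝ)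
    (u : EuclideanSpace ℝ (Fin (m + 1))) :
    ∫ θ in {θ ∈ Metric.sphere (0 : EuclideanSpace ℝ (Fin (m + 1))) 1 | c ≤ ⟪θ, e⟫},
        ⟪θ, u⟫ ∂μH[(m : ℝ)] =
      ⟪e, u⟫ * ∫ θ in {θ ∈ Metric.sphere (0 : EuclideanSpace ℝ (Fin (m + 1))) 1 | c ≤ ⟪θ, e⟫},
        ⟪θ, e⟫ ∂μH[(m : ℝ)] := by
  set C := {θ ∈ Metric.sphere (0 : EuclideanSpace ℝ (Fin (m + 1))) 1 | c ≤ ⟪θ, e⟫}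
  have hint : ∀ v, IntegrableOn (fun θ => ⟪θ, v⟫) C μH[(m : ℝ)] := fun v =>
    (Continuous.integrableOn_unitSphere
      (by fun_prop : Continuous fun θ : EuclideanSpace ℝ (Fin (m + 1)) => ⟪θ, v⟫)).mono_set
      fun θ hθ => hθ.1
  set R := (Submodule.span ℝ {e}).reflection
  have hR : ∀ θ, R θ = (2 * ⟪θ, e⟫) • e - θ := by
    intro θ
    rw [Submodule.reflection_singleton_apply, he, real_inner_comm]
    simp [two_smul, two_mul, add_smul]
  have hee : ⟪e, e⟫ = 1 := by rw [real_inner_self_eq_norm_sq, he]; norm_num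
  have hpre : R ⁻¹' C = C := by
    ext θ
    have : ⟪R θ, e⟫ = ⟪θ, e⟫ := by
      rw [hR, inner_sub_left, real_inner_smul_left, hee]; ring
    simp [C, this]
  have hmp := R.toIsometryEquiv.measurePreserving_hausdorffMeasure (m : ℝ)
  have h := hmp.setIntegral_preimage_emb R.toHomeomorph.measurableEmbedding (fun θ => ⟪θ, u⟫) C
  have h' : ∫ θ in C, ⟪R θ, u⟫ ∂μH[(m : ℝ)] = ∫ θ in C, ⟪θ, u⟫ ∂μH[(m : ℝ)] := by
    rw [← h]
    change _ = ∫ θ in R ⁻¹' C, ⟪R θ, u⟫ ∂μH[(m : ℝ)]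
    rw [hpre]
  have h2 : ∀ θ, ⟪R θ, u⟫ = 2 * ⟪e, u⟫ * ⟪θ, e⟫ - ⟪θ, u⟫ := by
    intro θ
    rw [hR, inner_sub_left, real_inner_smul_left]; ring
  simp only [h2] at h'
  rw [integral_sub ((hint e).const_mul _) (hint u), integral_const_mul] at h'
  linarith

lemma le_setIntegral_inner_cap {m : ℕ} {e u : EuclideanSpace ℝ (Fin (m + 1))} (he : ‖e‖ = 1)
    {ρ c r : ℝ} (hρ : ρ ^ 2 + c ^ 2 ≤ 1) (hc : 0 ≤ c) (hr : 0 ≤ r) (hu : r ≤ ⟪e, u⟫) :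
    r * (c * volume.real (Metric.closedBall (0 : EuclideanSpace ℝ (Fin m)) ρ)) ≤
      ∫ θ in {θ ∈ Metric.sphere (0 : EuclideanSpace ℝ (Fin (m + 1))) 1 | c ≤ ⟪θ, e⟫},
        ⟪θ, u⟫ ∂μH[(m : ℝ)] := by
  rw [setIntegral_inner_cap he]
  set C := {θ ∈ Metric.sphere (0 : EuclideanSpace ℝ (Fin (m + 1))) 1 | c ≤ ⟪θ, e⟫}
  have hfin : μH[(m : ℝ)] C < ⊤ :=
    (measure_mono fun θ hθ => hθ.1).trans_lt (hausdorffMeasure_unitSphere_lt_top m)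
  have h1 : volume.real (Metric.closedBall (0 : EuclideanSpace ℝ (Fin m)) ρ) ≤
      (μH[(m : ℝ)] : Measure (EuclideanSpace ℝ (Fin (m + 1)))).real C :=
    ENNReal.toReal_mono hfin.ne (volume_closedBall_le_hausdorffMeasure_cap he hρ)
  have hint : IntegrableOn (fun θ => ⟪θ, e⟫) C μH[(m : ℝ)] :=
    (Continuous.integrableOn_unitSphere
      (by fun_prop : Continuous fun θ : EuclideanSpace ℝ (Fin (m + 1)) => ⟪θ, e⟫)).mono_set
      fun θ hθ => hθ.1
  have h2 : c * (μH[(m : ℝ)] : Measure (EuclideanSpace ℝ (Fin (m + 1)))).real C ≤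
      ∫ θ in C, ⟪θ, e⟫ ∂μH[(m : ℝ)] :=
    setIntegral_ge_of_const_le_real (measurableSet_cap e c) hfin.ne (fun θ hθ => hθ.2) hint
  exact mul_le_mul hu ((mul_le_mul_of_nonneg_left h1 hc).trans h2) (by positivity) (hr.trans hu)

lemma sphereMeasureConst_pos {n : ℕ} (hn : 0 < n) : 0 < sphereMeasureConst n := by
  unfold sphereMeasureConst
  have : 0 < Real.Gamma ((n : ℝ) / 2) := Real.Gamma_pos_of_pos (by positivity)
  positivity

lemma volume_real_closedBall {m : ℕ} (hm : 0 < m) {ρ : ℝ} (hρ : 0 ≤ ρ) :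
    volume.real (Metric.closedBall (0 : EuclideanSpace ℝ (Fin m)) ρ) =
      ρ ^ m * (sphereMeasureConst m / m) := by
  have : Nonempty (Fin m) := Fin.pos_iff_nonempty.1 hm
  have hm' : (0 : ℝ) < m / 2 := by positivity
  have hG := Real.Gamma_pos_of_pos hm'
  rw [measureReal_def, EuclideanSpace.volume_closedBall, Fintype.card_fin,
    Real.Gamma_add_one hm'.ne', ENNReal.toReal_mul, ENNReal.toReal_pow, ENNReal.toReal_ofReal hρ,
    ENNReal.toReal_ofReal (by positivity), sphereMeasureConst, Real.sqrt_eq_rpow,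
    ← Real.rpow_mul_natCast Real.pi_pos.le]
  congr 1
  rw [show 1 / 2 * (m : ℝ) = m / 2 by ring]
  field_simp

lemma one_half_le_sqrt_pow (m : ℕ) : 1 / 2 ≤ √(1 - (m + 2 : ℝ)⁻¹) ^ (m + 2) := by
  have h0 : (m + 2 : ℝ)⁻¹ ≤ 1 := inv_le_one_of_one_le₀ (by linarith [Nat.cast_nonneg (α := ℝ) m])
  have h := one_add_mul_self_le_rpow_one_add (s := -(m + 2 : ℝ)⁻¹) (by linarith)
    (p := (m + 2 : ℝ) / 2) (by linarith [Nat.cast_nonneg (α := ℝ) m])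
  rw [Real.sqrt_eq_rpow, ← Real.rpow_mul_natCast (by linarith)]
  push_cast
  have hp : (0 : ℝ) < m + 2 := by positivity
  have e1 : 1 + (m + 2 : ℝ) / 2 * -(m + 2 : ℝ)⁻¹ = 1 / 2 := by field_simp; norm_num
  rw [e1] at h
  rwa [show 1 / 2 * (m + 2 : ℝ) = (m + 2) / 2 by ring, sub_eq_add_neg]

lemma isClosed_setOf_forall_inner_nonneg {E : Type*} [NormedAddCommGroup E]
    [InnerProductSpace ℝ E] (G : Set E) : IsClosed {θ : E | ∀ g ∈ G, 0 ≤ ⟪θ, g⟫} := by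
  have : {θ : E | ∀ g ∈ G, 0 ≤ ⟪θ, g⟫} = ⋂ g ∈ G, {θ | 0 ≤ ⟪θ, g⟫} := by ext; simp
  rw [this]
  exact isClosed_biInter fun g _ => isClosed_le continuous_const (by fun_prop)

/-- The sector polar to a family of vectors, provided that it lies in a hemisphere. -/
lemma isSector_polar {n : ℕ} {G : Set (EuclideanSpace ℝ (Fin n))}
    {u : EuclideanSpace ℝ (Fin n)} (hu : ‖u‖ = 1)
    (hdual : ∀ θ, (∀ g ∈ G, 0 ≤ ⟪θ, g⟫) → 0 ≤ ⟪u, θ⟫) :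
    IsSector {θ ∈ Metric.sphere (0 : EuclideanSpace ℝ (Fin n)) 1 | ∀ g ∈ G, 0 ≤ ⟪θ, g⟫} := by
  refine ⟨?_, ⟨{θ | ∀ g ∈ G, 0 ≤ ⟪θ, g⟫}, ?_, ?_, ?_⟩, u, hu, fun θ hθ => hdual θ hθ.2⟩
  · exact (isCompact_sphere _ _).inter_right <|
      (isClosed_setOf_forall_inner_nonneg G)
  · intro a ha b hb s t hs ht _ g hg
    rw [inner_add_left, real_inner_smul_left, real_inner_smul_left]
    have := ha g hg
    have := hb g hg
    positivity
  · intro a ha r hr g hg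
    rw [real_inner_smul_left]
    exact mul_nonneg hr (ha g hg)
  · ext θ; exact and_comm

/-- If a family of vectors has pairwise nonnegative inner products, then the sector polar to it
contains its dual sector. -/
lemma sectorDual_polar_subset {n : ℕ} {G : Set (EuclideanSpace ℝ (Fin n))}
    (hG : ∀ g ∈ G, ∀ k ∈ G, 0 ≤ ⟪g, k⟫) :
    sectorDual {θ ∈ Metric.sphere (0 : EuclideanSpace ℝ (Fin n)) 1 | ∀ g ∈ G, 0 ≤ ⟪θ, g⟫} ⊆
      {θ ∈ Metric.sphere (0 : EuclideanSpace ℝ (Fin n)) 1 | ∀ g ∈ G, 0 ≤ ⟪θ, g⟫} := by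
  rintro y ⟨hy, hyS⟩
  refine ⟨hy, fun g hg => ?_⟩
  rcases eq_or_ne g 0 with rfl | hg0
  · simp
  have hpos : 0 < ‖g‖ := norm_pos_iff.2 hg0
  have h := hyS (‖g‖⁻¹ • g) ⟨by simp [norm_smul, hpos.ne'], fun k hk => by
    rw [real_inner_smul_left]; exact mul_nonneg (by positivity) (hG g hg k hk)⟩
  rw [real_inner_smul_right] at h
  exact nonneg_of_mul_nonneg_right h (by positivity)

/-- Explicit lower bound for `Φ(S, u)` when `S` is polar to a family of vectors of pairwise
nonnegative inner products. -/
lemma le_PhiFun_polar {m : ℕ} (hm : 0 < m) {G : Set (EuclideanSpace ℝ (Fin (m + 1)))}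
    (hG : ∀ g ∈ G, ∀ k ∈ G, 0 ≤ ⟪g, k⟫) {u : EuclideanSpace ℝ (Fin (m + 1))}
    (hu : u ∈ sectorDual
      {θ ∈ Metric.sphere (0 : EuclideanSpace ℝ (Fin (m + 1))) 1 | ∀ g ∈ G, 0 ≤ ⟪θ, g⟫}) :
    sphereMeasureConst m / (sphereMeasureConst (m + 1) * m) * (√(m + 1 : ℝ))⁻¹ ^ (m + 1) ≤
      PhiFun {θ ∈ Metric.sphere (0 : EuclideanSpace ℝ (Fin (m + 1))) 1 | ∀ g ∈ G, 0 ≤ ⟪θ, g⟫}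
        u := by
  set S := {θ ∈ Metric.sphere (0 : EuclideanSpace ℝ (Fin (m + 1))) 1 | ∀ g ∈ G, 0 ≤ ⟪θ, g⟫}
    with hS
  have hDS : sectorDual S ⊆ S := sectorDual_polar_subset hG
  obtain ⟨e, he, hecap⟩ := exists_unit_inner_ge (A := sectorDual S) ⟨u, hu⟩
    (fun y hy => by simpa using hy.1) (fun y hy z hz => hy.2 z (hDS hz))
  rw [finrank_euclideanSpace_fin, Nat.cast_add_one, add_assoc, one_add_one_eq_two] at hecap
  set N : ℝ := m + 2 with hN
  have hNpos : 0 < N := by positivity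
  set c : ℝ := √(1 - N⁻¹) with hc
  have hc0 : 0 ≤ c := Real.sqrt_nonneg _
  have hN1 : N⁻¹ ≤ 1 := inv_le_one_of_one_le₀ (by linarith [Nat.cast_nonneg (α := ℝ) m])
  have hcsq : c ^ 2 = 1 - N⁻¹ := Real.sq_sqrt (by linarith)
  have hρsq : (√N)⁻¹ ^ 2 = N⁻¹ := by rw [inv_pow, Real.sq_sqrt hNpos.le]
  have hsub : {θ ∈ Metric.sphere (0 : EuclideanSpace ℝ (Fin (m + 1))) 1 | c ≤ ⟪θ, e⟫} ⊆ S := by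
    rintro θ ⟨hθ, hθe⟩
    refine ⟨hθ, fun g hg => ?_⟩
    rcases eq_or_ne g 0 with rfl | hg0
    · simp
    have hpos : 0 < ‖g‖ := norm_pos_iff.2 hg0
    have hgn : ‖‖g‖⁻¹ • g‖ = 1 := by simp [norm_smul, hpos.ne']
    have hgD : ‖g‖⁻¹ • g ∈ sectorDual S := by
      refine ⟨by simpa using hgn, fun x hx => ?_⟩
      rw [real_inner_smul_left, real_inner_comm]
      exact mul_nonneg (by positivity) (hx.2 g hg)
    have h1 := hecap _ hgD
    have h2 : 0 ≤ (√N)⁻¹ := by positivity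
    have h := inner_nonneg_of_one_le_sq_add_sq (by simpa using hθ) he hgn (hc0.trans hθe)
      (h2.trans h1) (by
        have := pow_le_pow_left₀ hc0 hθe 2
        have := pow_le_pow_left₀ h2 h1 2
        linarith)
    rw [real_inner_smul_right] at h
    exact nonneg_of_mul_nonneg_right h (by positivity)
  have hSm : MeasurableSet S :=
    (Metric.isClosed_sphere.inter (isClosed_setOf_forall_inner_nonneg G)).measurableSet
  have hmono : ∫ θ in {θ ∈ Metric.sphere (0 : EuclideanSpace ℝ (Fin (m + 1))) 1 | c ≤ ⟪θ, e⟫},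
      ⟪θ, u⟫ ∂μH[(m : ℝ)] ≤ ∫ θ in S, ⟪θ, u⟫ ∂μH[(m : ℝ)] := by
    refine setIntegral_mono_set ((Continuous.integrableOn_unitSphere (by fun_prop)).mono_set
      fun θ hθ => hθ.1) ?_ (.of_forall hsub)
    refine (ae_restrict_iff' hSm).2 (.of_forall fun θ hθ => ?_)
    simpa [real_inner_comm] using hu.2 θ hθ
  have hlow := (le_setIntegral_inner_cap he (ρ := (√N)⁻¹) (by rw [hρsq, hcsq]; linarith) hc0
    (by positivity) (hecap u hu)).trans hmono
  rw [volume_real_closedBall hm (by positivity)] at hlow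
  have hω := sphereMeasureConst_pos (Nat.succ_pos m)
  have hω' := sphereMeasureConst_pos hm
  have hm' : (0 : ℝ) < m := by exact_mod_cast hm
  rw [PhiFun, Nat.cast_add_one, add_sub_cancel_right]
  have hρc : (√N)⁻¹ = (√(m + 1 : ℝ))⁻¹ * c := by
    have : 1 - N⁻¹ = (m + 1) / N := by rw [hN]; field_simp; ring
    rw [hc, this, Real.sqrt_div (by positivity)]
    have : 0 < √(m + 1 : ℝ) := by positivity
    field_simp
  have hkey : (√(m + 1 : ℝ))⁻¹ ^ (m + 1) ≤ 2 * ((√N)⁻¹ ^ (m + 1) * c) := by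
    rw [hρc, mul_pow, mul_assoc, ← pow_succ]
    have h1 := one_half_le_sqrt_pow m
    have h2 : 0 ≤ (√(m + 1 : ℝ))⁻¹ ^ (m + 1) := by positivity
    nlinarith
  calc sphereMeasureConst m / (sphereMeasureConst (m + 1) * m) * (√(m + 1 : ℝ))⁻¹ ^ (m + 1)
      ≤ sphereMeasureConst m / (sphereMeasureConst (m + 1) * m) *
        (2 * ((√N)⁻¹ ^ (m + 1) * c)) := by gcongr
    _ = 2 / sphereMeasureConst (m + 1) *
        ((√N)⁻¹ * (c * ((√N)⁻¹ ^ m * (sphereMeasureConst m / m)))) := by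
      rw [pow_succ]; field_simp
    _ ≤ _ := by gcongr

/-- A steepest descent curve moves away from each of its past points. -/
lemma norm_sub_le_norm_sub_of_inner_deriv_nonneg {E : Type*} [NormedAddCommGroup E]
    [InnerProductSpace ℝ E] {x x' : ℝ → E} {L σ τ s : ℝ} (hlip : LipschitzOnWith 1 x (Icc 0 L))
    (hderiv : ∀ᵐ s ∂(volume.restrict (Icc 0 L)), HasDerivWithinAt x (x' s) (Icc 0 L) s ∧
      ∀ σ ∈ Icc (0 : ℝ) s, 0 ≤ ⟪x' s, x s - x σ⟫)
    (h0 : 0 ≤ σ) (hστ : σ ≤ τ) (hτs : τ ≤ s) (hsL : s ≤ L) :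
    ‖x τ - x σ‖ ≤ ‖x s - x σ‖ := by
  have hsub : Icc τ s ⊆ Icc 0 L := Icc_subset_Icc (h0.trans hστ) hsL
  have hσ : σ ∈ Icc 0 L := ⟨h0, by linarith⟩
  have hL : 0 ≤ L := hσ.1.trans hσ.2
  have hbd : ∀ t ∈ Icc τ s, ‖x t - x σ‖ ≤ L := fun t ht => by
    have := hlip.dist_le_mul t (hsub ht) σ hσ
    rw [dist_eq_norm, Real.dist_eq, abs_of_nonneg (by linarith [ht.1])] at this
    simp only [NNReal.coe_one, one_mul] at this
    linarith [(hsub ht).2]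
  have hlip2 : LipschitzOnWith (Real.toNNReal (2 * L)) (fun t => ‖x t - x σ‖ ^ 2) (Icc τ s) := by
    refine LipschitzOnWith.of_dist_le_mul fun t ht t' ht' => ?_
    rw [Real.coe_toNNReal _ (by linarith)]
    have h1 := hlip.dist_le_mul t (hsub ht) t' (hsub ht')
    rw [dist_eq_norm] at h1
    simp only [NNReal.coe_one, one_mul] at h1
    have h2 := abs_norm_sub_norm_le (x t - x σ) (x t' - x σ)
    rw [sub_sub_sub_cancel_right] at h2
    rw [Real.dist_eq, sq_sub_sq, abs_mul,
      abs_of_nonneg (by positivity : 0 ≤ ‖x t - x σ‖ + ‖x t' - x σ‖)]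
    refine mul_le_mul ?_ (h2.trans h1) (abs_nonneg _) (by linarith)
    linarith [hbd t ht, hbd t' ht']
  have hd : ∀ᵐ t ∂(volume.restrict (Icc τ s)), 0 ≤ deriv (fun t => ‖x t - x σ‖ ^ 2) t := by
    have h := ae_restrict_of_ae_restrict_of_subset (Ioo_subset_Icc_self.trans hsub) hderiv
    rw [← Measure.restrict_congr_set Ioo_ae_eq_Icc]
    filter_upwards [h, ae_restrict_mem measurableSet_Ioo] with t ⟨ht, hin⟩ htI
    have hx : HasDerivAt x (x' t) t := ht.hasDerivAt
      (Icc_mem_nhds (by linarith [htI.1]) (by linarith [htI.2]))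
    rw [(hx.sub_const (x σ)).norm_sq.deriv, real_inner_comm]
    have := hin σ ⟨h0, by linarith [htI.1]⟩
    positivity
  have := hlip2.le_of_ae_deriv_nonneg hτs hd
  exact le_of_sq_le_sq this (norm_nonneg _)

lemma inner_sub_sub_nonneg_of_norm_sub_le {E : Type*} [NormedAddCommGroup E]
    [InnerProductSpace ℝ E] {a b c : E} (h : ‖b - a‖ ≤ ‖c - a‖) : 0 ≤ ⟪c - a, c - b⟫ := by
  have h1 : b - a = (c - a) - (c - b) := by abel
  have h2 := norm_sub_sq_real (c - a) (c - b)
  rw [← h1] at h2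
  have h3 := pow_le_pow_left₀ (norm_nonneg _) h 2
  nlinarith [sq_nonneg ‖c - b‖]

section SupportFunction

variable {n : ℕ} {K : Set (EuclideanSpace ℝ (Fin n))}

lemma IsCompact.bddAbove_inner_image (hK : IsCompact K) (θ : EuclideanSpace ℝ (Fin n)) :
    BddAbove ((fun y => ⟪θ, y⟫) '' K) :=
  hK.bddAbove_image (by fun_prop)

lemma IsCompact.inner_le_suppFn (hK : IsCompact K) (θ : EuclideanSpace ℝ (Fin n))
    {y : EuclideanSpace ℝ (Fin n)} (hy : y ∈ K) : ⟪θ, y⟫ ≤ suppFn K θ :=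
  le_csSup (hK.bddAbove_inner_image θ) ⟨y, hy, rfl⟩

lemma suppFn_le (hne : K.Nonempty) {θ : EuclideanSpace ℝ (Fin n)} {r : ℝ}
    (h : ∀ y ∈ K, ⟪θ, y⟫ ≤ r) : suppFn K θ ≤ r :=
  csSup_le (hne.image _) (by rintro _ ⟨y, hy, rfl⟩; exact h y hy)

lemma IsCompact.suppFn_convexHull (hK : IsCompact K) (hne : K.Nonempty)
    (θ : EuclideanSpace ℝ (Fin n)) : suppFn (convexHull ℝ K) θ = suppFn K θ := by
  have hle : ∀ y ∈ convexHull ℝ K, ⟪θ, y⟫ ≤ suppFn K θ := fun y hy =>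
    convexHull_min (t := {y | ⟪θ, y⟫ ≤ suppFn K θ}) (fun z hz => hK.inner_le_suppFn θ hz)
      (convex_halfSpace_le (innerₗ _ θ).isLinear _) hy
  refine le_antisymm (suppFn_le hne.convexHull hle) (suppFn_le hne fun y hy => ?_)
  exact le_csSup ⟨_, by rintro _ ⟨z, hz, rfl⟩; exact hle z hz⟩
    ⟨y, subset_convexHull ℝ K hy, rfl⟩

lemma IsCompact.continuous_suppFn (hK : IsCompact K) : Continuous (suppFn K) :=
  hK.continuous_sSup (f := fun θ y : EuclideanSpace ℝ (Fin n) => ⟪θ, y⟫)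
    (by simp only [Function.HasUncurry.uncurry, id]; fun_prop)

end SupportFunction

lemma IsCompact.meanWidth_convexHull_eq {m : ℕ} {K : Set (EuclideanSpace ℝ (Fin (m + 1)))}
    (hK : IsCompact K) (hne : K.Nonempty) :
    meanWidth (convexHull ℝ K) = 2 / sphereMeasureConst (m + 1) *
      ∫ θ in Metric.sphere (0 : EuclideanSpace ℝ (Fin (m + 1))) 1, suppFn K θ ∂μH[(m : ℝ)] := by
  rw [meanWidth, Nat.cast_add_one, add_sub_cancel_right]
  simp only [hK.suppFn_convexHull hne]

/-- Adding points to a compact set increases the mean width of its convex hull at least by the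
contribution of any part of the sphere on which a given point of the set is extremal. -/
lemma setIntegral_inner_le_meanWidth_sub {m : ℕ} {K K' : Set (EuclideanSpace ℝ (Fin (m + 1)))}
    (hK : IsCompact K) (hK' : IsCompact K') (hKK' : K ⊆ K') {p q : EuclideanSpace ℝ (Fin (m + 1))}
    (hp : p ∈ K) (hq : q ∈ K') {S : Set (EuclideanSpace ℝ (Fin (m + 1)))} (hSm : MeasurableSet S)
    (hS : S ⊆ Metric.sphere 0 1) (hext : ∀ θ ∈ S, ∀ y ∈ K, ⟪θ, y⟫ ≤ ⟪θ, p⟫) :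
    2 / sphereMeasureConst (m + 1) * ∫ θ in S, ⟪θ, q - p⟫ ∂μH[(m : ℝ)] ≤
      meanWidth (convexHull ℝ K') - meanWidth (convexHull ℝ K) := by
  rw [hK.meanWidth_convexHull_eq ⟨p, hp⟩, hK'.meanWidth_convexHull_eq ⟨q, hq⟩, ← mul_sub]
  have hω := sphereMeasureConst_pos (Nat.succ_pos m)
  refine mul_le_mul_of_nonneg_left ?_ (by positivity)
  have hi := Continuous.integrableOn_unitSphere hK.continuous_suppFn
  have hi' := Continuous.integrableOn_unitSphere hK'.continuous_suppFn
  rw [← integral_sub hi' hi]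
  calc ∫ θ in S, ⟪θ, q - p⟫ ∂μH[(m : ℝ)]
      ≤ ∫ θ in S, (suppFn K' θ - suppFn K θ) ∂μH[(m : ℝ)] := by
        refine setIntegral_mono_on ((Continuous.integrableOn_unitSphere (by fun_prop)).mono_set hS)
          ((hi'.sub hi).mono_set hS) hSm fun θ hθ => ?_
        rw [inner_sub_right]
        exact sub_le_sub (hK'.inner_le_suppFn θ hq) (suppFn_le ⟨p, hp⟩ (hext θ hθ))
    _ ≤ ∫ θ in Metric.sphere 0 1, (suppFn K' θ - suppFn K θ) ∂μH[(m : ℝ)] := by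
        refine setIntegral_mono_set (hi'.sub hi) (.of_forall fun θ => ?_) (.of_forall hS)
        exact sub_nonneg.2 (suppFn_le ⟨p, hp⟩ fun y hy => hK'.inner_le_suppFn θ (hKK' hy))

/-- At a point where both sides are differentiable, the mean width of the convex hull of a curve
grows at least at the rate `Φ(S, x')`, with `S` the normal sector at the endpoint. -/
lemma PhiFun_le_deriv_meanWidth {m : ℕ} {x : ℝ → EuclideanSpace ℝ (Fin (m + 1))} {L s : ℝ}
    (hx : ContinuousOn x (Icc 0 L)) (h0 : 0 ≤ s) (hsL : s < L)
    {u : EuclideanSpace ℝ (Fin (m + 1))} (hu : HasDerivAt x u s)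
    (hf : DifferentiableAt ℝ (fun t => meanWidth (convexHull ℝ (x '' Icc 0 t))) s) :
    PhiFun {θ ∈ Metric.sphere (0 : EuclideanSpace ℝ (Fin (m + 1))) 1 |
      ∀ g ∈ (fun σ => x s - x σ) '' Icc 0 s, 0 ≤ ⟪θ, g⟫} u ≤
      deriv (fun t => meanWidth (convexHull ℝ (x '' Icc 0 t))) s := by
  set S := {θ ∈ Metric.sphere (0 : EuclideanSpace ℝ (Fin (m + 1))) 1 |
      ∀ g ∈ (fun σ => x s - x σ) '' Icc 0 s, 0 ≤ ⟪θ, g⟫}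
  set f := fun t => meanWidth (convexHull ℝ (x '' Icc 0 t))
  have hcpt : ∀ t ≤ L, IsCompact (x '' Icc 0 t) := fun t ht =>
    isCompact_Icc.image_of_continuousOn (hx.mono (Icc_subset_Icc_right ht))
  have hSm : MeasurableSet S :=
    (Metric.isClosed_sphere.inter (isClosed_setOf_forall_inner_nonneg _)).measurableSet
  have hSs : S ⊆ Metric.sphere 0 1 := fun θ hθ => hθ.1
  have hint : IntegrableOn (fun θ : EuclideanSpace ℝ (Fin (m + 1)) => θ) S μH[(m : ℝ)] :=
    (Continuous.integrableOn_unitSphere continuous_id).mono_set hSs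
  have hlin : ∀ v, ∫ θ in S, ⟪θ, v⟫ ∂μH[(m : ℝ)] = ⟪v, ∫ θ in S, θ ∂μH[(m : ℝ)]⟫ := fun v => by
    rw [← integral_inner hint]
    simp only [real_inner_comm]
  have h1 : HasDerivAt (fun t => 2 / sphereMeasureConst (m + 1) *
      ⟪x t, ∫ θ in S, θ ∂μH[(m : ℝ)]⟫) (PhiFun S u) s := by
    rw [PhiFun, Nat.cast_add_one, add_sub_cancel_right, hlin]
    simpa using (hu.inner ℝ (hasDerivAt_const s (∫ θ in S, θ ∂μH[(m : ℝ)]))).const_mul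
      (2 / sphereMeasureConst (m + 1))
  have hs1 := (hasDerivWithinAt_iff_tendsto_slope' (by simp)).1
    (hf.hasDerivAt.hasDerivWithinAt (s := Ioi s))
  have hs2 := (hasDerivWithinAt_iff_tendsto_slope' (by simp)).1
    (h1.hasDerivWithinAt (s := Ioi s))
  refine le_of_tendsto_of_tendsto hs2 hs1 ?_
  filter_upwards [Ioo_mem_nhdsGT hsL] with t ht
  have hts : 0 < t - s := sub_pos.2 ht.1
  have hkey := setIntegral_inner_le_meanWidth_sub (hcpt s hsL.le) (hcpt t ht.2.le)
    (image_mono (Icc_subset_Icc_right ht.1.le)) (p := x s) (q := x t)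
    ⟨s, ⟨h0, le_rfl⟩, rfl⟩ ⟨t, ⟨h0.trans ht.1.le, le_rfl⟩, rfl⟩ hSm hSs (by
      rintro θ hθ _ ⟨σ, hσ, rfl⟩
      have := hθ.2 _ ⟨σ, hσ, rfl⟩
      rw [inner_sub_right] at this
      linarith)
  rw [hlin, inner_sub_left, mul_sub] at hkey
  rw [slope_def_field, slope_def_field]
  exact div_le_div_of_nonneg_right hkey hts.le

lemma monotoneOn_meanWidth_convexHull_image {m : ℕ} {x : ℝ → EuclideanSpace ℝ (Fin (m + 1))}
    {L : ℝ} (hx : ContinuousOn x (Icc 0 L)) :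
    MonotoneOn (fun t => meanWidth (convexHull ℝ (x '' Icc 0 t))) (Icc 0 L) := by
  intro s hs t ht hst
  have hcpt : ∀ t ≤ L, IsCompact (x '' Icc 0 t) := fun t ht =>
    isCompact_Icc.image_of_continuousOn (hx.mono (Icc_subset_Icc_right ht))
  have := setIntegral_inner_le_meanWidth_sub (hcpt s hs.2) (hcpt t ht.2)
    (image_mono (Icc_subset_Icc_right hst)) (p := x s) (q := x t) (S := ∅)
    ⟨s, ⟨hs.1, le_rfl⟩, rfl⟩ ⟨t, ⟨ht.1, le_rfl⟩, rfl⟩ .empty (empty_subset _) (by simp)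
  simpa using this

lemma inner_nonneg_of_hasDerivAt {E : Type*} [NormedAddCommGroup E] [InnerProductSpace ℝ E]
    {x : ℝ → E} {s : ℝ} {u θ : E} (hs : 0 < s) (hu : HasDerivAt x u s)
    (hθ : ∀ σ ∈ Icc 0 s, 0 ≤ ⟪θ, x s - x σ⟫) : 0 ≤ ⟪u, θ⟫ := by
  have h1 : HasDerivAt (fun t => ⟪x t, θ⟫) ⟪u, θ⟫ s := by
    simpa using hu.inner ℝ (hasDerivAt_const s θ)
  refine ge_of_tendsto ((hasDerivWithinAt_iff_tendsto_slope' (by simp)).1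
    (h1.hasDerivWithinAt (s := Iio s))) ?_
  filter_upwards [Ioo_mem_nhdsLT hs] with t ht
  have := hθ t ⟨ht.1.le, ht.2.le⟩
  rw [real_inner_comm, inner_sub_left] at this
  rw [slope_def_field]
  exact div_nonneg_of_nonpos (by linarith) (by linarith [ht.2])

/-- for a steepest descent curve, a.e. the derivative of the mean
width of the convex hull is bounded below by
`m_n = min {Φ(S,u) : S sector, S ⊇ S*, u ∈ S*}`, and in particular by the
explicit Santaló bound. -/
theorem meanWidth_deriv_lower_bound {n : ℕ} (hn : 2 ≤ n) (L : ℝ) (hL : 0 < L)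
    (x x' : ℝ → EuclideanSpace ℝ (Fin n))
    (hlip : LipschitzOnWith 1 x (Icc 0 L))
    (hderiv : ∀ᵐ s ∂(volume.restrict (Icc 0 L)),
      HasDerivWithinAt x (x' s) (Icc 0 L) s ∧ ‖x' s‖ = 1 ∧
        ∀ σ ∈ Icc (0:ℝ) s, 0 ≤ ⟪x' s, x s - x σ⟫) :
    ∀ᵐ s ∂(volume.restrict (Icc 0 L)),
      sInf {r : ℝ | ∃ S : Set (EuclideanSpace ℝ (Fin n)),
          ∃ u : EuclideanSpace ℝ (Fin n),
          IsSector S ∧ sectorDual S ⊆ S ∧ u ∈ sectorDual S ∧ r = PhiFun S u}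
        ≤ deriv (fun t => meanWidth (convexHull ℝ (x '' Icc 0 t))) s ∧
      sphereMeasureConst (n - 1) / (sphereMeasureConst n * (n - 1)) * (Real.sqrt n)⁻¹ ^ n
        ≤ deriv (fun t => meanWidth (convexHull ℝ (x '' Icc 0 t))) s := by
  obtain ⟨m, rfl⟩ : ∃ m, n = m + 1 := ⟨n - 1, by omega⟩
  have hm : 0 < m := by omega
  have hx : ContinuousOn x (Icc 0 L) := hlip.continuousOn
  have hmono := (monotoneOn_meanWidth_convexHull_image hx).mono Ioo_subset_Icc_self
  have hdiff := hmono.ae_differentiableWithinAt measurableSet_Ioo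
  have hderiv' := ae_restrict_of_ae_restrict_of_subset Ioo_subset_Icc_self hderiv
  rw [← Measure.restrict_congr_set Ioo_ae_eq_Icc]
  filter_upwards [hderiv', hdiff, ae_restrict_mem measurableSet_Ioo] with s ⟨hxs, hu1, _⟩ hfs hs
  have hu : HasDerivAt x (x' s) s := hxs.hasDerivAt (Icc_mem_nhds hs.1 hs.2)
  have hΦ := PhiFun_le_deriv_meanWidth hx hs.1.le hs.2 hu
    (hfs.differentiableAt (Ioo_mem_nhds hs.1 hs.2))
  set G := (fun σ => x s - x σ) '' Icc 0 s with hGdef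
  have hG : ∀ g ∈ G, ∀ k ∈ G, 0 ≤ ⟪g, k⟫ := by
    have key : ∀ σ τ, 0 ≤ σ → σ ≤ τ → τ ≤ s → 0 ≤ ⟪x s - x σ, x s - x τ⟫ := fun σ τ h0 h1 h2 =>
      inner_sub_sub_nonneg_of_norm_sub_le <| norm_sub_le_norm_sub_of_inner_deriv_nonneg hlip
        (hderiv.mono fun _ h => ⟨h.1, h.2.2⟩) h0 h1 h2 hs.2.le
    rintro _ ⟨σ, hσ, rfl⟩ _ ⟨τ, hτ, rfl⟩
    rcases le_total σ τ with h | h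
    · exact key σ τ hσ.1 h hτ.2
    · rw [real_inner_comm]
      exact key τ σ hτ.1 h hσ.2
  have hdual : ∀ θ, (∀ g ∈ G, 0 ≤ ⟪θ, g⟫) → 0 ≤ ⟪x' s, θ⟫ := fun θ hθ =>
    inner_nonneg_of_hasDerivAt hs.1 hu fun σ hσ => hθ _ ⟨σ, hσ, rfl⟩
  have huD : x' s ∈ sectorDual {θ ∈ Metric.sphere (0 : EuclideanSpace ℝ (Fin (m + 1))) 1 |
      ∀ g ∈ G, 0 ≤ ⟪θ, g⟫} :=
    ⟨mem_sphere_zero_iff_norm.2 hu1, fun θ hθ => hdual θ hθ.2⟩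
  refine ⟨le_trans (csInf_le ⟨0, ?_⟩ ⟨_, x' s, isSector_polar hu1 hdual,
    sectorDual_polar_subset hG, huD, rfl⟩) hΦ, le_trans (le_of_eq ?_) (le_PhiFun_polar hm hG huD
      |>.trans hΦ)⟩
  · rintro _ ⟨S, v, hS, -, hv, rfl⟩
    have hω := sphereMeasureConst_pos (Nat.succ_pos m)
    refine mul_nonneg (by positivity) (setIntegral_nonneg hS.1.measurableSet fun θ hθ => ?_)
    rw [real_inner_comm]
    exact hv.2 θ hθ
  · push_cast
    simp only [add_tsub_cancel_right]
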